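/- arXiv:alg-geom/9705013 — 2 statements merged into one kernel-verified Lean document; each statement's English description precedes it below -/
import Mathlib

section
/- Let η, ζ ∈ S_∞. Then η ⪯ ζ (i.e., there exist u ∈ S_∞ and k ∈ ℕ with u ≤_k ηu ≤_k ζu) if and only if all three of the following hold: (1) for every α with α < η(α), one has η(α) ≤ ζ(α); (2) for every α with α > η(α), one has η(α) ≥ ζ(α); (3) whenever α < β with either α, β ∈ up_ζ or α, β ∈ down_ζ, and ζ(α) < ζ(β), one has η(α) < η(β). -/
/-- A permutation of the positive integers belongs to `S_∞` when it moves only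
finitely many points. -/
def FinSupp (w : Equiv.Perm ℕ+) : Prop := {x : ℕ+ | w x ≠ x}.Finite

/-- The length `ℓ(w)` of a permutation: its number of inversions, i.e. of pairs
`i < j` with `w i > w j`. -/
noncomputable def len (w : Equiv.Perm ℕ+) : ℕ :=
  Set.ncard {p : ℕ+ × ℕ+ | p.1 < p.2 ∧ w p.2 < w p.1}

/-- Covering relation of the `k`-Bruhat order: `u ⋖_k u(a,b)` for `a ≤ k < b`
with `ℓ(u(a,b)) = ℓ(u) + 1`.  Here `u(a,b) = u * (swap a b)`. -/
def kBruhatCov (k : ℕ+) (u w : Equiv.Perm ℕ+) : Prop :=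
  ∃ a b : ℕ+, a ≤ k ∧ k < b ∧ w = u * Equiv.swap a b ∧ len w = len u + 1

/-- The `k`-Bruhat order `u ≤_k w`: a chain of `k`-Bruhat covers from `u` to `w`
(or `u = w`). -/
def kBruhat (k : ℕ+) : Equiv.Perm ℕ+ → Equiv.Perm ℕ+ → Prop :=
  Relation.ReflTransGen (kBruhatCov k)
/-- The new partial order `⪯` on `S_∞`: `η ⪯ ζ` iff there exist `u ∈ S_∞` and
`k` with `u ≤_k ηu ≤_k ζu`. -/
def NewOrder (η ζ : Equiv.Perm ℕ+) : Prop :=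
  ∃ (u : Equiv.Perm ℕ+) (k : ℕ+), FinSupp u ∧
    kBruhat k u (η * u) ∧ kBruhat k (η * u) (ζ * u)

open Equiv

/-- The inversions of a permutation. -/
def inversions (w : Perm ℕ+) : Set (ℕ+ × ℕ+) := {p | p.1 < p.2 ∧ w p.2 < w p.1}

/-- The characterisation of the `k`-Bruhat order: values weakly increase at positions at most `k`,
weakly decrease at later positions, and two positions on the same side of `k` never acquire an
inversion. -/
structure KBruhatCriterion (k : ℕ+) (u w : Perm ℕ+) : Prop where
  le_of_le : ∀ a ≤ k, u a ≤ w a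
  le_of_lt : ∀ b, k < b → w b ≤ u b
  lt_of_lt : ∀ i j, i < j → (j ≤ k ∨ k < i) → u i < u j → w i < w j

/-- Apply `swap a b` to both entries of a pair, unless this reverses their order. -/
def swapPair (a b : ℕ+) (p : ℕ+ × ℕ+) : ℕ+ × ℕ+ :=
  if swap a b p.1 < swap a b p.2 then (swap a b p.1, swap a b p.2) else p

section FinSupp

theorem FinSupp.mul {v w : Perm ℕ+} (hv : FinSupp v) (hw : FinSupp w) : FinSupp (v * w) := by
  refine (hv.union hw).subset fun x hx => ?_
  by_contra h
  simp only [Set.mem_union, Set.mem_ofPred_eq, not_or, not_not] at h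
  exact hx (by simp [h.1, h.2])

theorem FinSupp.inv {w : Perm ℕ+} (hw : FinSupp w) : FinSupp w⁻¹ := by
  refine hw.subset fun x hx h => hx ?_
  rw [Perm.inv_eq_iff_eq, h]

theorem finSupp_swap (a b : ℕ+) : FinSupp (swap a b) := by
  refine (Set.toFinite {a, b}).subset fun x hx => ?_
  by_contra h
  simp only [Set.mem_insert_iff, Set.mem_singleton_iff, not_or] at h
  exact hx (swap_apply_of_ne_of_ne h.1 h.2)

theorem FinSupp.finite_inversions {w : Perm ℕ+} (hw : FinSupp w) : (inversions w).Finite := by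
  obtain ⟨N, hN⟩ := hw.bddAbove
  have fix : ∀ x, N < x → w x = x := fun x hx => by
    by_contra h
    exact absurd (hN h) (not_le.2 hx)
  refine ((Set.finite_Iic N).prod (Set.finite_Iic N)).subset ?_
  rintro ⟨i, j⟩ ⟨hij, hw⟩
  dsimp only at hij hw
  have hj : j ≤ N := by
    by_contra h
    rw [not_le] at h
    rw [fix j h] at hw
    have := w.injective (fix (w i) (h.trans hw))
    order
  exact ⟨hij.le.trans hj, hj⟩

end FinSupp

section Length

theorem swapPair_lt {a b : ℕ+} {p : ℕ+ × ℕ+} (hp : p.1 < p.2) :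
    (swapPair a b p).1 < (swapPair a b p).2 := by
  unfold swapPair
  split_ifs with h
  · exact h
  · exact hp

theorem swapPair_swapPair (a b : ℕ+) {p : ℕ+ × ℕ+} (hp : p.1 < p.2) :
    swapPair a b (swapPair a b p) = p := by
  by_cases h : swap a b p.1 < swap a b p.2
  · simp [swapPair, h, hp]
  · simp [swapPair, h]

theorem swapPair_injOn (a b : ℕ+) : Set.InjOn (swapPair a b) {p | p.1 < p.2} := by
  intro p hp q hq h
  rw [← swapPair_swapPair a b hp, h, swapPair_swapPair a b hq]

/-- The pairs whose order is reversed by a transposition. -/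
theorem reversed_by_swap {a b i j : ℕ+} (hab : a < b) (hij : i < j)
    (h : ¬ swap a b i < swap a b j) :
    (i = a ∧ j = b) ∨ (i = a ∧ j < b) ∨ (a < i ∧ j = b) := by
  rw [swap_apply_def, swap_apply_def] at h
  split_ifs at h <;> grind

theorem swapPair_mem_inversions {u : Perm ℕ+} {a b : ℕ+} (hab : a < b) (hu : u a < u b)
    {p : ℕ+ × ℕ+} (hp : p ∈ inversions u) :
    swapPair a b p ∈ inversions (u * swap a b) \ {(a, b)} := by
  obtain ⟨i, j⟩ := p
  obtain ⟨hij, h⟩ := hp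
  dsimp only at hij h
  unfold swapPair
  split_ifs with hs
  · refine ⟨⟨hs, by simpa using h⟩, ?_⟩
    simp only [Set.mem_singleton_iff, Prod.mk.injEq, not_and]
    intro h1 h2
    rw [swap_apply_eq_iff, swap_apply_left] at h1
    rw [swap_apply_eq_iff, swap_apply_right] at h2
    order
  · rcases reversed_by_swap hab hij hs with ⟨rfl, rfl⟩ | ⟨rfl, hj⟩ | ⟨hi, rfl⟩
    · order
    · refine ⟨⟨hij, ?_⟩, by simp [hj.ne]⟩
      simp only [Perm.mul_apply, swap_apply_left, swap_apply_of_ne_of_ne hij.ne' hj.ne]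
      order
    · refine ⟨⟨hij, ?_⟩, by simp [hi.ne']⟩
      simp only [Perm.mul_apply, swap_apply_right, swap_apply_of_ne_of_ne hi.ne' hij.ne]
      order

theorem swapPair_mem_inversions_of_cover {u : Perm ℕ+} {a b : ℕ+} (hab : a < b)
    (hc : ∀ c, a < c → c < b → ¬ (u a < u c ∧ u c < u b))
    {p : ℕ+ × ℕ+} (hp : p ∈ inversions (u * swap a b) \ {(a, b)}) :
    swapPair a b p ∈ inversions u := by
  obtain ⟨i, j⟩ := p
  obtain ⟨⟨hij, h⟩, hne⟩ := hp
  dsimp only at hij h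
  unfold swapPair
  split_ifs with hs
  · exact ⟨hs, by simpa using h⟩
  · rcases reversed_by_swap hab hij hs with ⟨rfl, rfl⟩ | ⟨rfl, hj⟩ | ⟨hi, rfl⟩
    · exact absurd rfl hne
    · simp only [Perm.mul_apply, swap_apply_left, swap_apply_of_ne_of_ne hij.ne' hj.ne] at h
      refine ⟨hij, lt_of_le_of_ne ?_ (u.injective.ne hij.ne')⟩
      exact not_lt.1 fun h' => hc j hij hj ⟨h', h⟩
    · simp only [Perm.mul_apply, swap_apply_right, swap_apply_of_ne_of_ne hi.ne' hij.ne] at h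
      refine ⟨hij, lt_of_le_of_ne ?_ (u.injective.ne hij.ne')⟩
      exact not_lt.1 fun h' => hc i hi hij ⟨h, h'⟩

theorem mem_inversions_mul_swap {u : Perm ℕ+} {a b : ℕ+} (hab : a < b) (hu : u a < u b) :
    (a, b) ∈ inversions (u * swap a b) := ⟨hab, by simpa using hu⟩

theorem len_mul_swap_of_cover {u : Perm ℕ+} (hfin : FinSupp u) {a b : ℕ+} (hab : a < b)
    (hu : u a < u b) (hc : ∀ c, a < c → c < b → ¬ (u a < u c ∧ u c < u b)) :
    len (u * swap a b) = len u + 1 := by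
  have hfin' := (hfin.mul (finSupp_swap a b)).finite_inversions
  have himg : swapPair a b '' inversions u = inversions (u * swap a b) \ {(a, b)} := by
    refine Set.Subset.antisymm ?_ fun p hp =>
      ⟨_, swapPair_mem_inversions_of_cover hab hc hp, swapPair_swapPair a b hp.1.1⟩
    rintro _ ⟨p, hp, rfl⟩
    exact swapPair_mem_inversions hab hu hp
  have h1 := Set.InjOn.ncard_image
    ((swapPair_injOn a b).mono (fun p (hp : p ∈ inversions u) => hp.1))
  rw [himg] at h1
  have h2 := Set.ncard_sdiff_singleton_add_one (mem_inversions_mul_swap hab hu) hfin'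
  change (inversions _).ncard = (inversions _).ncard + 1
  omega

theorem len_lt_len_mul_swap {u : Perm ℕ+} (hfin : FinSupp u) {a b : ℕ+} (hab : a < b)
    (hu : u a < u b) : len u < len (u * swap a b) := by
  have hfin' := (hfin.mul (finSupp_swap a b)).finite_inversions
  have h1 := Set.ncard_le_ncard_of_injOn (swapPair a b)
    (fun p hp => swapPair_mem_inversions hab hu hp)
    ((swapPair_injOn a b).mono (fun p (hp : p ∈ inversions u) => hp.1)) hfin'.sdiff
  have h2 := Set.ncard_sdiff_singleton_add_one (mem_inversions_mul_swap hab hu) hfin'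
  change (inversions _).ncard < (inversions _).ncard
  omega

theorem len_add_one_lt_len_mul_swap {u : Perm ℕ+} (hfin : FinSupp u) {a b c : ℕ+}
    (hac : a < c) (hcb : c < b) (hau : u a < u c) (hub : u c < u b) :
    len u + 1 < len (u * swap a b) := by
  have hab := hac.trans hcb
  have hu := hau.trans hub
  have hfin' := (hfin.mul (finSupp_swap a b)).finite_inversions
  have hac' : (a, c) ∈ inversions (u * swap a b) \ {(a, b)} :=
    ⟨⟨hac, by simpa [swap_apply_of_ne_of_ne hac.ne' hcb.ne] using hub⟩, by simp [hcb.ne]⟩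
  have hfix : swapPair a b (a, c) = (a, c) := by
    simp [swapPair, swap_apply_of_ne_of_ne hac.ne' hcb.ne, hcb.le]
  have h1 := Set.ncard_le_ncard_of_injOn (s := inversions u)
    (t := (inversions (u * swap a b) \ {(a, b)}) \ {(a, c)}) (swapPair a b)
    (fun p hp => ⟨swapPair_mem_inversions hab hu hp, fun h => by
      rw [Set.mem_singleton_iff, ← hfix] at h
      have := swapPair_injOn a b hp.1 (show (a, c) ∈ {p : ℕ+ × ℕ+ | p.1 < p.2} from hac) h
      subst this
      exact absurd hp.2 hau.asymm⟩)
    ((swapPair_injOn a b).mono (fun p (hp : p ∈ inversions u) => hp.1)) hfin'.sdiff.sdiff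
  have h2 := Set.ncard_sdiff_singleton_add_one (mem_inversions_mul_swap hab hu) hfin'
  have h3 := Set.ncard_sdiff_singleton_add_one hac' hfin'.sdiff
  change (inversions _).ncard + 1 < (inversions _).ncard
  omega

end Length

section Criterion

theorem KBruhatCriterion.refl (k : ℕ+) (u : Perm ℕ+) : KBruhatCriterion k u u :=
  ⟨fun _ _ => le_rfl, fun _ _ => le_rfl, fun _ _ _ _ h => h⟩

theorem KBruhatCriterion.trans {k : ℕ+} {u v w : Perm ℕ+} (h : KBruhatCriterion k u v)
    (h' : KBruhatCriterion k v w) : KBruhatCriterion k u w :=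
  ⟨fun a ha => (h.le_of_le a ha).trans (h'.le_of_le a ha),
    fun b hb => (h'.le_of_lt b hb).trans (h.le_of_lt b hb),
    fun i j hij hk hu => h'.lt_of_lt i j hij hk (h.lt_of_lt i j hij hk hu)⟩

theorem kBruhatCov.finSupp {k : ℕ+} {u w : Perm ℕ+} (hu : FinSupp u) (h : kBruhatCov k u w) :
    FinSupp w := by
  obtain ⟨a, b, -, -, rfl, -⟩ := h
  exact hu.mul (finSupp_swap a b)

theorem kBruhatCov.criterion {k : ℕ+} {u w : Perm ℕ+} (hu : FinSupp u)
    (h : kBruhatCov k u w) : KBruhatCriterion k u w := by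
  obtain ⟨a, b, hak, hkb, rfl, hlen⟩ := h
  have hab := hak.trans_lt hkb
  have huab : u a < u b := by
    by_contra h
    have h' : u b < u a := lt_of_le_of_ne (not_lt.1 h) (u.injective.ne hab.ne')
    have := len_lt_len_mul_swap (hu.mul (finSupp_swap a b)) hab (by simpa using h')
    rw [mul_assoc, swap_mul_self, mul_one] at this
    omega
  have hc : ∀ c, a < c → c < b → ¬ (u a < u c ∧ u c < u b) := by
    rintro c h1 h2 ⟨h3, h4⟩
    have := len_add_one_lt_len_mul_swap hu h1 h2 h3 h4
    omega
  refine ⟨fun x hx => ?_, fun x hx => ?_, fun i j hij hk hlt => ?_⟩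
  · rw [Perm.mul_apply, swap_apply_def]
    split_ifs <;> grind
  · rw [Perm.mul_apply, swap_apply_def]
    split_ifs <;> grind
  · have hi := hc i
    have hj := hc j
    have hbj := u.injective.ne_iff (x := b) (y := j)
    have hai := u.injective.ne_iff (x := a) (y := i)
    rw [Perm.mul_apply, Perm.mul_apply, swap_apply_def, swap_apply_def]
    split_ifs <;> grind

theorem kBruhat.criterion {k : ℕ+} {u w : Perm ℕ+} (hu : FinSupp u)
    (h : kBruhat k u w) : KBruhatCriterion k u w := by
  suffices FinSupp w ∧ KBruhatCriterion k u w from this.2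
  induction h with
  | refl => exact ⟨hu, .refl k u⟩
  | tail _ h ih => exact ⟨h.finSupp ih.1, ih.2.trans (h.criterion ih.1)⟩

/-- Sublevel sets of permutations at the same level are equinumerous, so an inclusion between
them is an equality. -/
theorem lt_of_sublevel_subset {v w : Perm ℕ+} {m : ℕ+} (h : ∀ x, v x < m → w x < m)
    {x : ℕ+} (hx : w x < m) : v x < m := by
  have himg : ∀ σ : Perm ℕ+, {x | σ x < m} = σ.symm '' Set.Iio m := fun σ => by
    ext x
    simp
  have hfin : {x | w x < m}.Finite := by
    rw [himg]
    exact (Set.finite_Iio m).image _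
  have hcard : {x | w x < m}.ncard ≤ {x | v x < m}.ncard := by
    rw [himg, himg, Set.ncard_image_of_injective _ (Equiv.injective _),
      Set.ncard_image_of_injective _ (Equiv.injective _)]
  have heq : {x | v x < m} = {x | w x < m} := Set.eq_of_subset_of_ncard_le h hcard hfin
  exact heq.symm.subset hx

theorem KBruhatCriterion.eq_of_forall_le {k : ℕ+} {u w : Perm ℕ+} (h : KBruhatCriterion k u w)
    (hle : ∀ a ≤ k, w a ≤ u a) : u = w := by
  have heq : ∀ a ≤ k, u a = w a := fun a ha => (h.le_of_le a ha).antisymm (hle a ha)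
  suffices ∀ v b, w b = v → u b = w b from Equiv.ext fun b => this _ b rfl
  intro v
  induction v using WellFoundedLT.induction with
  | ind v ih =>
    rintro b rfl
    rcases le_or_gt b k with hb | hb
    · exact heq b hb
    · have hc : u (u.symm (w b)) = w b := u.apply_symm_apply _
      generalize u.symm (w b) = c at hc
      have hwc : u c = w c := by
        rcases le_or_gt c k with hck | hck
        · exact heq c hck
        · rcases (h.le_of_lt c hck).lt_or_eq with hlt | hwc
          · exact ih (w c) (hc ▸ hlt) c rfl
          · exact hwc.symm
      have : c = b := w.injective (hwc.symm.trans hc)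
      rw [← this, hwc]

/-- A permutation strictly above `u` for the criterion can be lowered by a `k`-Bruhat cover. -/
theorem KBruhatCriterion.exists_swap {k : ℕ+} {u w : Perm ℕ+} (h : KBruhatCriterion k u w)
    (hne : u ≠ w) :
    ∃ a b, a ≤ k ∧ k < b ∧ w b < w a ∧ (∀ c, a < c → c < b → ¬ (w b < w c ∧ w c < w a)) ∧
      KBruhatCriterion k u (w * swap a b) := by
  obtain ⟨a, ⟨hak, hua⟩, hmin⟩ : ∃ a ∈ {a | a ≤ k ∧ u a < w a},
      ∀ c ∈ {a | a ≤ k ∧ u a < w a}, u a ≤ u c := by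
    refine Set.exists_min_image _ u ((Set.finite_Iic k).subset fun a ha => ha.1) ?_
    by_contra hempty
    refine hne (h.eq_of_forall_le fun a ha => not_lt.1 fun hlt => hempty ⟨a, ha, hlt⟩)
  have hfix : ∀ c ≤ k, u c < u a → w c = u c := fun c hc hlt =>
    le_antisymm (not_lt.1 fun h' => (hmin c ⟨hc, h'⟩).not_gt hlt) (h.le_of_le c hc)
  have hlow : ∀ x, w x < u a → u x < u a := fun x hx => by
    refine lt_of_sublevel_subset (v := u) (w := w) (fun y hy => ?_) hx
    rcases le_or_gt y k with hyk | hyk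
    · rwa [hfix y hyk hy]
    · exact (h.le_of_lt y hyk).trans_lt hy
  obtain ⟨b₀, hkb₀, hwb₀, hub₀⟩ : ∃ b, k < b ∧ w b < w a ∧ w a ≤ u b := by
    by_contra! hno
    refine lt_irrefl (w a) (lt_of_sublevel_subset (v := w) (w := u) (fun y hy => ?_) hua)
    rcases le_or_gt y k with hyk | hyk
    · exact (h.le_of_le y hyk).trans_lt hy
    · exact hno y hyk hy
  obtain ⟨b, ⟨hkb, hwb⟩, hmax⟩ : ∃ b ∈ {b | k < b ∧ w b < w a},
      ∀ c ∈ {b | k < b ∧ w b < w a}, u c ≤ u b := by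
    refine Set.exists_max_image _ u (Set.Finite.subset
      ((Set.finite_Iio (w a)).preimage w.injective.injOn) fun b hb => hb.2) ⟨b₀, hkb₀, hwb₀⟩
  have hub : w a ≤ u b := hub₀.trans (hmax b₀ ⟨hkb₀, hwb₀⟩)
  have huwb : u a ≤ w b := not_lt.1 fun hlt => by
    have := hlow b hlt
    order
  refine ⟨a, b, hak, hkb, hwb, ?_, ?_, ?_, ?_⟩
  · rintro c hac hcb ⟨h1, h2⟩
    rcases le_or_gt c k with hck | hck
    · rcases lt_trichotomy (u c) (u a) with hlt | heq | hgt
      · have := hfix c hck hlt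
        order
      · exact hac.ne' (u.injective heq)
      · have := h.lt_of_lt a c hac (.inl hck) hgt
        order
    · have hle := hmax c ⟨hck, h2⟩
      have := h.lt_of_lt c b hcb (.inr hck) (lt_of_le_of_ne hle (u.injective.ne hcb.ne))
      order
  · intro x hx
    have := h.le_of_le x hx
    rw [Perm.mul_apply, swap_apply_def]
    split_ifs <;> grind
  · intro x hx
    have := h.le_of_lt x hx
    rw [Perm.mul_apply, swap_apply_def]
    split_ifs <;> grind
  · intro i j hij hk hlt
    have hw := h.lt_of_lt i j hij hk hlt
    rw [Perm.mul_apply, Perm.mul_apply, swap_apply_def, swap_apply_def]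
    split_ifs with h1 h2 h3 h4 h5 h6 h7
    · grind
    · grind
    · subst h1
      order
    · grind
    · grind
    · subst h4
      refine lt_of_le_of_ne (not_lt.1 fun hlt' => ?_) (w.injective.ne (Ne.symm h5))
      have := hmax j ⟨by grind, hlt'⟩
      order
    · subst h7
      have := hfix i (by grind) hlt
      order
    · grind
    · exact hw

theorem KBruhatCriterion.kBruhat {k : ℕ+} {u w : Perm ℕ+} (h : KBruhatCriterion k u w)
    (hw : FinSupp w) : kBruhat k u w := by
  generalize hn : len w = n
  induction n using Nat.strong_induction_on generalizing w with
  | _ n ih =>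
    by_cases hne : u = w
    · exact hne ▸ Relation.ReflTransGen.refl
    · obtain ⟨a, b, hak, hkb, hwab, hc, h'⟩ := h.exists_swap hne
      have hab := hak.trans_lt hkb
      have hfin := hw.mul (finSupp_swap a b)
      have hws : w = w * swap a b * swap a b := by rw [mul_assoc, swap_mul_self, mul_one]
      have hlen : len w = len (w * swap a b) + 1 := by
        conv_lhs => rw [hws]
        refine len_mul_swap_of_cover hfin hab (by simpa using hwab) fun c h1 h2 => ?_
        simpa [swap_apply_of_ne_of_ne h1.ne' h2.ne] using hc c h1 h2
      exact (ih _ (by omega) h' hfin rfl).tail ⟨a, b, hak, hkb, hws, hlen⟩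

end Criterion

section Grassmannian

/-- The position of `x` when the elements of `A` are listed increasingly, followed by the
remaining positive integers, also increasingly. -/
def grassmannianPos (A : Finset ℕ+) (x : ℕ+) : ℕ :=
  if x ∈ A then (A.filter (· ≤ x)).card else x + (A.filter (x < ·)).card

theorem grassmannianPos_pos (A : Finset ℕ+) (x : ℕ+) : 0 < grassmannianPos A x := by
  unfold grassmannianPos
  split_ifs with h
  · exact Finset.card_pos.2 ⟨x, by simp [h]⟩
  · exact Nat.add_pos_left x.pos _

theorem grassmannianPos_le {A : Finset ℕ+} {x : ℕ+} (hx : x ∈ A) :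
    grassmannianPos A x ≤ A.card := by
  rw [grassmannianPos, if_pos hx]
  exact Finset.card_filter_le _ _

theorem lt_grassmannianPos {A : Finset ℕ+} {x : ℕ+} (hx : x ∉ A) :
    A.card < grassmannianPos A x := by
  rw [grassmannianPos, if_neg hx, ← Finset.card_filter_add_card_filter_not (s := A) (· < x)]
  have h1 : (A.filter (· < x)).card < x := by
    have := Finset.card_le_card (s := A.filter (· < x)) (t := Finset.Ico 1 x) fun y hy => by
      simpa using (Finset.mem_filter.1 hy).2
    rw [PNat.card_Ico] at this
    have := x.pos
    simp only [PNat.one_coe] at *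
    omega
  have h2 : A.filter (¬ · < x) = A.filter (x < ·) := Finset.filter_congr fun y hy => by
    have : y ≠ x := fun h => hx (h ▸ hy)
    grind
  rw [h2]
  omega

theorem grassmannianPos_lt {A : Finset ℕ+} {x y : ℕ+} (h : x ∈ A ↔ y ∈ A) (hxy : x < y) :
    grassmannianPos A x < grassmannianPos A y := by
  by_cases hy : y ∈ A
  · rw [grassmannianPos, if_pos (h.2 hy), grassmannianPos, if_pos hy]
    refine Finset.card_lt_card ⟨fun z hz => ?_, fun hsub => ?_⟩
    · simp only [Finset.mem_filter] at hz ⊢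
      exact ⟨hz.1, hz.2.trans hxy.le⟩
    · have := hsub (Finset.mem_filter.2 ⟨hy, le_rfl⟩)
      exact (Finset.mem_filter.1 this).2.not_gt hxy
  · rw [grassmannianPos, if_neg (mt h.1 hy), grassmannianPos, if_neg hy]
    have h1 : A.filter (x < ·) ⊆ A.filter (y < ·) ∪ Finset.Ioo x y := fun z hz => by
      simp only [Finset.mem_filter, Finset.mem_union, Finset.mem_Ioo] at hz ⊢
      have : z ≠ y := fun h => hy (h ▸ hz.1)
      grind
    have h2 := (Finset.card_le_card h1).trans (Finset.card_union_le _ _)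
    rw [PNat.card_Ioo] at h2
    have : (x : ℕ) < y := hxy
    omega

/-- The inverse of a Grassmannian permutation: it lists `A` in increasing order at the first
`A.card` positions, and the complement of `A` in increasing order at the later ones. -/
theorem exists_perm_lt_of_mem_iff (A : Finset ℕ+) :
    ∃ p : Perm ℕ+, FinSupp p ∧ (∀ x, x ∈ A ↔ (p x : ℕ) ≤ A.card) ∧
      ∀ x y, (x ∈ A ↔ y ∈ A) → x < y → p x < p y := by
  let f : ℕ+ → ℕ+ := fun x => ⟨grassmannianPos A x, grassmannianPos_pos A x⟩
  have hmem : ∀ x, x ∈ A ↔ (f x : ℕ) ≤ A.card := fun x =>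
    ⟨grassmannianPos_le, fun h => by_contra fun hx => (lt_grassmannianPos hx).not_ge h⟩
  have hlt : ∀ x y, (x ∈ A ↔ y ∈ A) → x < y → f x < f y := fun x y h hxy =>
    grassmannianPos_lt h hxy
  have hinj : Function.Injective f := fun x y hxy => by
    have h : x ∈ A ↔ y ∈ A := by rw [hmem, hmem, hxy]
    rcases lt_trichotomy x y with h' | h' | h'
    · exact absurd hxy (hlt x y h h').ne
    · exact h'
    · exact absurd hxy (hlt y x h.symm h').ne'
  obtain ⟨N, hN⟩ := A.bddAbove
  have hfix : ∀ x, N < x → f x = x := fun x hx => by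
    have hxA : x ∉ A := fun h => (hN h).not_gt hx
    have : A.filter (x < ·) = ∅ := Finset.filter_false_of_mem fun y hy => by
      have : y ≤ N := hN hy
      order
    apply PNat.eq
    simp [f, grassmannianPos, hxA, this]
  have hmaps : ∀ x ≤ N, f x ≤ N := fun x hx => by
    by_contra! h
    have := hinj (hfix (f x) h)
    order
  have hsurj : Function.Surjective f := fun y => by
    rcases le_or_gt y N with hy | hy
    · obtain ⟨x, -, hx⟩ := Finset.surjOn_of_injOn_of_card_le (s := Finset.Iic N)
        (t := Finset.Iic N) f (fun x hx => by simpa using hmaps x (by simpa using hx))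
        hinj.injOn le_rfl (by simpa using hy : y ∈ (Finset.Iic N : Set ℕ+))
      exact ⟨x, hx⟩
    · exact ⟨y, hfix y hy⟩
  refine ⟨Equiv.ofBijective f ⟨hinj, hsurj⟩, ?_, hmem, hlt⟩
  exact (Set.finite_Iic N).subset fun x hx => not_lt.1 fun h => hx (hfix x h)

end Grassmannian

/-- Characterisation of `⪯`: `η ⪯ ζ` iff (1) `α < η(α)` implies `η(α) ≤ ζ(α)`;
(2) `α > η(α)` implies `η(α) ≥ ζ(α)`; and (3) if `α < β` with `α,β ∈ up_ζ` or
`α,β ∈ down_ζ` and `ζ(α) < ζ(β)`, then `η(α) < η(β)`. -/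
theorem stmt_9 (η ζ : Equiv.Perm ℕ+) (hη : FinSupp η) (hζ : FinSupp ζ) :
    NewOrder η ζ ↔
      ((∀ α : ℕ+, α < η α → η α ≤ ζ α) ∧
       (∀ α : ℕ+, η α < α → ζ α ≤ η α) ∧
       (∀ α β : ℕ+, α < β →
          ((α < ζ α ∧ β < ζ β) ∨ (ζ α < α ∧ ζ β < β)) →
          ζ α < ζ β → η α < η β)) := by
  constructor
  · rintro ⟨u, k, hu, h1, h2⟩
    replace h1 := h1.criterion hu
    replace h2 := h2.criterion (hη.mul hu)
    have hup : ∀ α, u.symm α ≤ k → α ≤ η α ∧ η α ≤ ζ α := fun α hα =>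
      ⟨by simpa using h1.le_of_le _ hα, by simpa using h2.le_of_le _ hα⟩
    have hdown : ∀ α, k < u.symm α → η α ≤ α ∧ ζ α ≤ η α := fun α hα =>
      ⟨by simpa using h1.le_of_lt _ hα, by simpa using h2.le_of_lt _ hα⟩
    refine ⟨fun α hα => ?_, fun α hα => ?_, fun α β hαβ hside hζαβ => ?_⟩
    · exact (hup α (not_lt.1 fun h => (hdown α h).1.not_gt hα)).2
    · exact (hdown α (not_le.1 fun h => (hup α h).1.not_gt hα)).2
    · have hside' : (u.symm α ≤ k ∧ u.symm β ≤ k) ∨ (k < u.symm α ∧ k < u.symm β) := by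
        have := hup α
        have := hup β
        have := hdown α
        have := hdown β
        grind
      rcases lt_trichotomy (u.symm α) (u.symm β) with hlt | heq | hgt
      · simpa using h1.lt_of_lt _ _ hlt (by grind) (by simpa using hαβ)
      · exact absurd (u.symm.injective heq) hαβ.ne
      · by_contra hle
        have hlt : η β < η α := lt_of_le_of_ne (not_lt.1 hle) (η.injective.ne hαβ.ne')
        have := h2.lt_of_lt _ _ hgt (by grind) (by simpa using hlt)
        simp only [Perm.mul_apply, apply_symm_apply] at this
        order
  · rintro ⟨h1, h2, h3⟩
    have hup : ∀ x, x ≤ ζ x → x ≤ η x ∧ η x ≤ ζ x := by grind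
    have hdown : ∀ x, ζ x ≤ x → η x ≤ x ∧ ζ x ≤ η x := by grind
    have h3' : ∀ x y, x < y → (x ≤ ζ x ∧ y ≤ ζ y) ∨ (ζ x ≤ x ∧ ζ y ≤ y) → ζ x < ζ y →
        η x < η y := fun x y => by
      have := h3 x y
      have := hup x
      have := hup y
      have := hdown x
      have := hdown y
      grind
    have hfinite : {x | x = 1 ∨ x < ζ x}.Finite :=
      ((Set.finite_singleton 1).union hζ).subset fun x hx => hx.imp id fun h => h.ne'
    let A : Finset ℕ+ := hfinite.toFinset.map ζ.toEmbedding
    have hA : ∀ x, ζ x ∈ A ↔ x = 1 ∨ x < ζ x := fun x => by simp [A]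
    have hAcard : 0 < A.card := Finset.card_pos.2 ⟨ζ 1, (hA 1).2 (.inl rfl)⟩
    obtain ⟨p, hp, hpA, hlt⟩ := exists_perm_lt_of_mem_iff A
    let k : ℕ+ := ⟨A.card, hAcard⟩
    have hpA : ∀ x, ζ x ∈ A ↔ p (ζ x) ≤ k := fun x => hpA (ζ x)
    let u : Perm ℕ+ := ζ⁻¹ * p⁻¹
    have hpu : ∀ i, p (ζ (u i)) = i := fun i => by simp [u]
    have hle : ∀ i ≤ k, u i ≤ ζ (u i) := fun i hi => by
      have := (hA (u i)).1 ((hpA (u i)).2 ((hpu i).symm ▸ hi))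
      rcases this with h | h
      · rw [h]
        exact one_le
      · exact h.le
    have hge : ∀ i, k < i → ζ (u i) ≤ u i := fun i hi => by
      have := mt (hA (u i)).2 (mt (hpA (u i)).1 (by rw [hpu]; exact hi.not_ge))
      exact not_lt.1 fun h => this (.inr h)
    have hmono : ∀ i j, i < j → (j ≤ k ∨ k < i) → ζ (u i) < ζ (u j) := fun i j hij hk => by
      have hiff : ζ (u j) ∈ A ↔ ζ (u i) ∈ A := by
        rw [hpA, hpA, hpu, hpu]
        grind
      by_contra hle
      have hne : ζ (u j) ≠ ζ (u i) := fun h => hij.ne' (u.injective (ζ.injective h))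
      have := hlt _ _ hiff (lt_of_le_of_ne (not_lt.1 hle) hne)
      rw [hpu, hpu] at this
      order
    have hu : FinSupp u := hζ.inv.mul hp.inv
    refine ⟨u, k, hu, KBruhatCriterion.kBruhat ⟨?_, ?_, ?_⟩ (hη.mul hu),
      KBruhatCriterion.kBruhat ⟨?_, ?_, ?_⟩ (hζ.mul hu)⟩
    · exact fun i hi => (hup _ (hle i hi)).1
    · exact fun i hi => (hdown _ (hge i hi)).1
    · intro i j hij hk hlt'
      refine h3' _ _ hlt' ?_ (hmono i j hij hk)
      exact hk.imp (fun h => ⟨hle i (hij.le.trans h), hle j h⟩)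
        (fun h => ⟨hge i h, hge j (h.trans hij)⟩)
    · exact fun i hi => (hup _ (hle i hi)).2
    · exact fun i hi => (hdown _ (hge i hi)).2
    · exact fun i j hij hk _ => hmono i j hij hk
end

section
/- Let ζ ∈ S_∞. The map η ↦ ηζ⁻¹ is an order-reversing bijection from the interval [e,ζ]_⪯ = {η : e ⪯ η ⪯ ζ} onto the interval [e,ζ⁻¹]_⪯ = {η : e ⪯ η ⪯ ζ⁻¹}: for η, ξ ∈ [e,ζ]_⪯ one has η ⪯ ξ if and only if ξζ⁻¹ ⪯ ηζ⁻¹. -/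
namespace KBruhat

open Equiv

/-- The set of inversions of a permutation. -/
def inversions (w : Perm ℕ+) : Set (ℕ+ × ℕ+) := {p | p.1 < p.2 ∧ w p.2 < w p.1}

lemma len_eq (w : Perm ℕ+) : len w = (inversions w).ncard := rfl

lemma finSupp_mul {u v : Perm ℕ+} (hu : FinSupp u) (hv : FinSupp v) : FinSupp (u * v) := by
  refine (Set.Finite.union hu hv).subset fun x hx => ?_
  by_contra h
  simp only [Set.mem_union, Set.mem_ofPred_eq, not_or, not_not] at h
  exact hx (by rw [Perm.mul_apply, h.2, h.1])

lemma finSupp_swap (a b : ℕ+) : FinSupp (swap a b) := by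
  refine (Set.toFinite {a, b}).subset fun x hx => ?_
  by_contra h
  simp only [Set.mem_insert_iff, Set.mem_singleton_iff, not_or] at h
  exact hx (swap_apply_of_ne_of_ne h.1 h.2)

lemma finite_inversions {w : Perm ℕ+} (hw : FinSupp w) : (inversions w).Finite := by
  obtain ⟨N, hN⟩ := hw.bddAbove
  have fix : ∀ x, N < x → w x = x := fun x hx => by
    by_contra h
    exact absurd (hN h) (not_le.mpr hx)
  refine ((Set.finite_Iic N).prod (Set.finite_Iic N)).subset ?_
  rintro ⟨i, j⟩ ⟨hij, hw'⟩
  simp only at hij hw'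
  have hj : j ≤ N := by
    by_contra! hj
    rw [fix j hj] at hw'
    have h := w.injective (fix (w i) (hj.trans hw'))
    exact absurd (h ▸ hw') (not_lt.mpr hij.le)
  exact ⟨hij.le.trans hj, hj⟩

/-- The pairs of positions whose order is reversed by the transposition `(a, b)`. -/
def reversedPairs (a b : ℕ+) : Set (ℕ+ × ℕ+) := {p | p.1 < p.2 ∧ swap a b p.2 < swap a b p.1}

lemma ncard_inversions_diff_mul_swap (u : Perm ℕ+) (a b : ℕ+) :
    (inversions (u * swap a b) \ reversedPairs a b).ncard =
      (inversions u \ reversedPairs a b).ncard := by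
  refine Set.ncard_congr (fun p _ => (swap a b p.1, swap a b p.2)) ?_ ?_ ?_
  · rintro ⟨i, j⟩ ⟨⟨hij, h⟩, hQ⟩
    simp only [reversedPairs, Set.mem_ofPred_eq, not_and, not_lt, Perm.mul_apply] at hij h hQ
    have hne : swap a b i ≠ swap a b j := (swap a b).injective.ne hij.ne
    refine ⟨⟨lt_of_le_of_ne (hQ hij) hne, h⟩, ?_⟩
    simp [reversedPairs, hij.le]
  · rintro ⟨i, j⟩ ⟨i', j'⟩ _ _ h
    simpa using h
  · rintro ⟨i, j⟩ ⟨⟨hij, h⟩, hQ⟩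
    simp only [reversedPairs, Set.mem_ofPred_eq, not_and, not_lt] at hij h hQ
    have hne : swap a b i ≠ swap a b j := (swap a b).injective.ne hij.ne
    refine ⟨(swap a b i, swap a b j), ⟨⟨lt_of_le_of_ne (hQ hij) hne, ?_⟩, ?_⟩, ?_⟩
    · simpa using h
    · simp [reversedPairs, hij.le]
    · simp

lemma mem_reversedPairs {a b : ℕ+} (hab : a < b) {i j : ℕ+} :
    (i, j) ∈ reversedPairs a b ↔
      i = a ∧ j = b ∨ i = a ∧ a < j ∧ j < b ∨ j = b ∧ a < i ∧ i < b := by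
  simp only [reversedPairs, Set.mem_ofPred_eq, swap_apply_def]
  grind

lemma insert_inversions_subset {u : Perm ℕ+} {a b : ℕ+} (hab : a < b) (h : u a < u b) :
    insert (a, b) (inversions u ∩ reversedPairs a b) ⊆
      inversions (u * swap a b) ∩ reversedPairs a b := by
  rintro ⟨i, j⟩ hp
  rw [Set.mem_insert_iff, Set.mem_inter_iff, mem_reversedPairs hab] at hp
  rw [Set.mem_inter_iff, mem_reversedPairs hab]
  simp only [inversions, Set.mem_ofPred_eq, Perm.mul_apply, Prod.mk.injEq, swap_apply_def] at hp ⊢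
  grind

lemma subset_insert_inversions_iff {u : Perm ℕ+} {a b : ℕ+} (hab : a < b) :
    inversions (u * swap a b) ∩ reversedPairs a b ⊆
        insert (a, b) (inversions u ∩ reversedPairs a b) ↔
      ∀ c, a < c → c < b → ¬ (u a < u c ∧ u c < u b) := by
  constructor
  · intro hs c hac hcb hc
    have hmem : (a, c) ∈ inversions (u * swap a b) ∩ reversedPairs a b := by
      rw [Set.mem_inter_iff, mem_reversedPairs hab]
      simp only [inversions, Set.mem_ofPred_eq, Perm.mul_apply, swap_apply_def]
      grind
    have := hs hmem
    simp only [inversions, Set.mem_insert_iff, Set.mem_inter_iff, Set.mem_ofPred_eq,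
      Prod.mk.injEq] at this
    grind
  · rintro hc ⟨i, j⟩ hp
    rw [Set.mem_inter_iff, mem_reversedPairs hab] at hp
    rw [Set.mem_insert_iff, Set.mem_inter_iff, mem_reversedPairs hab]
    have hinj : ∀ x y, u x = u y → x = y := fun _ _ h => u.injective h
    simp only [inversions, Set.mem_ofPred_eq, Perm.mul_apply, Prod.mk.injEq,
      swap_apply_def] at hp ⊢
    grind

lemma ncard_insert_inversions {u : Perm ℕ+} (hu : FinSupp u) {a b : ℕ+} (h : u a < u b) :
    (insert (a, b) (inversions u ∩ reversedPairs a b)).ncard =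
      (inversions u ∩ reversedPairs a b).ncard + 1 :=
  Set.ncard_insert_of_notMem (fun hm => absurd hm.1.2 (not_lt.mpr h.le))
    ((finite_inversions hu).inter_of_left _)

lemma len_mul_swap_add {u : Perm ℕ+} (hu : FinSupp u) (a b : ℕ+) :
    len (u * swap a b) + (inversions u ∩ reversedPairs a b).ncard =
      len u + (inversions (u * swap a b) ∩ reversedPairs a b).ncard := by
  have h₁ := Set.ncard_inter_add_ncard_sdiff_eq_ncard (inversions u) (reversedPairs a b)
    (finite_inversions hu)
  have h₂ := Set.ncard_inter_add_ncard_sdiff_eq_ncard (inversions (u * swap a b))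
    (reversedPairs a b) (finite_inversions (finSupp_mul hu (finSupp_swap a b)))
  rw [ncard_inversions_diff_mul_swap] at h₂
  rw [len_eq, len_eq]
  omega

lemma len_lt_len_mul_swap {u : Perm ℕ+} (hu : FinSupp u) {a b : ℕ+} (hab : a < b)
    (h : u a < u b) : len u < len (u * swap a b) := by
  have h₁ := len_mul_swap_add hu a b
  have h₂ := Set.ncard_le_ncard (insert_inversions_subset hab h)
    ((finite_inversions (finSupp_mul hu (finSupp_swap a b))).inter_of_left _)
  rw [ncard_insert_inversions hu h] at h₂
  omega

lemma len_mul_swap_eq_iff {u : Perm ℕ+} (hu : FinSupp u) {a b : ℕ+} (hab : a < b) :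
    len (u * swap a b) = len u + 1 ↔
      u a < u b ∧ ∀ c, a < c → c < b → ¬ (u a < u c ∧ u c < u b) := by
  have hv := finSupp_mul hu (finSupp_swap a b)
  rcases lt_or_ge (u a) (u b) with h | h
  · have h₁ := len_mul_swap_add hu a b
    have h₂ := insert_inversions_subset hab h
    have hfin := (finite_inversions hv).inter_of_left (reversedPairs a b)
    have h₃ := ncard_insert_inversions hu h
    rw [← subset_insert_inversions_iff hab]
    refine ⟨fun hl => ⟨h, ?_⟩, fun hs => ?_⟩
    · exact (Set.eq_of_subset_of_ncard_le h₂ (by omega) hfin).ge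
    · rw [← h₂.antisymm hs.2, h₃] at h₁
      omega
  · have hlt : u b < u a := lt_of_le_of_ne h (u.injective.ne hab.ne')
    have := len_lt_len_mul_swap hv hab (by simpa using hlt)
    rw [mul_assoc, swap_mul_self, mul_one] at this
    exact ⟨fun hl => by omega, fun hl => absurd hl.1 (not_lt.mpr h)⟩

lemma kBruhatCov_iff {k : ℕ+} {u w : Perm ℕ+} (hu : FinSupp u) :
    kBruhatCov k u w ↔ ∃ a b : ℕ+, a ≤ k ∧ k < b ∧ w = u * swap a b ∧ u a < u b ∧
      ∀ c, a < c → c < b → ¬ (u a < u c ∧ u c < u b) := by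
  refine exists₂_congr fun a b => and_congr_right fun ha => and_congr_right fun hb =>
    and_congr_right ?_
  rintro rfl
  exact len_mul_swap_eq_iff hu (ha.trans_lt hb)

lemma FinSupp.of_kBruhatCov {k : ℕ+} {u w : Perm ℕ+} (hu : FinSupp u) (h : kBruhatCov k u w) :
    FinSupp w := by
  obtain ⟨a, b, -, -, rfl, -⟩ := h
  exact finSupp_mul hu (finSupp_swap a b)

lemma FinSupp.of_kBruhat {k : ℕ+} {u w : Perm ℕ+} (hu : FinSupp u) (h : kBruhat k u w) :
    FinSupp w := by
  induction h with
  | refl => exact hu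
  | tail _ h ih => exact FinSupp.of_kBruhatCov ih h

/-- A necessary condition for `u ≤_k w` that can be read off from values. -/
structure Compatible (k : ℕ+) (u w : Perm ℕ+) : Prop where
  le_of_le : ∀ a ≤ k, u a ≤ w a
  le_of_gt : ∀ b, k < b → w b ≤ u b
  separated : ∀ a b, a < b → u a < u b → w b < w a → a ≤ k ∧ k < b

lemma Compatible.refl (k : ℕ+) (u : Perm ℕ+) : Compatible k u u :=
  ⟨fun _ _ => le_rfl, fun _ _ => le_rfl, fun _ _ _ h h' => absurd h h'.not_gt⟩

lemma Compatible.trans {k : ℕ+} {u v w : Perm ℕ+} (h₁ : Compatible k u v)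
    (h₂ : Compatible k v w) : Compatible k u w where
  le_of_le a ha := (h₁.le_of_le a ha).trans (h₂.le_of_le a ha)
  le_of_gt b hb := (h₂.le_of_gt b hb).trans (h₁.le_of_gt b hb)
  separated a b hab hu hw := by
    rcases lt_or_ge (v a) (v b) with h | h
    · exact h₂.separated a b hab h hw
    · exact h₁.separated a b hab hu (lt_of_le_of_ne h (v.injective.ne hab.ne'))

lemma Compatible.of_kBruhatCov {k : ℕ+} {u w : Perm ℕ+} (hu : FinSupp u)
    (h : kBruhatCov k u w) : Compatible k u w := by
  obtain ⟨a, b, ha, hb, rfl, hlt, hc⟩ := (kBruhatCov_iff hu).1 h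
  constructor
  · intro i hi
    rw [Perm.mul_apply, swap_apply_def]
    grind
  · intro i hi
    rw [Perm.mul_apply, swap_apply_def]
    grind
  · intro i j hij huij hw
    rw [Perm.mul_apply, Perm.mul_apply, swap_apply_def, swap_apply_def] at hw
    have hi := hc i
    have hj := hc j
    grind

lemma Compatible.of_kBruhat {k : ℕ+} {u w : Perm ℕ+} (hu : FinSupp u)
    (h : kBruhat k u w) : Compatible k u w := by
  induction h with
  | refl => exact Compatible.refl k u
  | tail h₁ h₂ ih => exact ih.trans (.of_kBruhatCov (FinSupp.of_kBruhat hu h₁) h₂)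

/-- A first step of a chain from `u` to `w` can be replayed from any `x` compatible
with `w u⁻¹ x`. -/
lemma Compatible.replay_kBruhatCov {k l : ℕ+} {u v w x : Perm ℕ+} (hu : FinSupp u)
    (hx : FinSupp x) (huv : kBruhatCov k u v) (hvw : Compatible k v w)
    (hxw : Compatible l x (w * u⁻¹ * x)) :
    kBruhatCov l x (v * u⁻¹ * x) ∧ Compatible l (v * u⁻¹ * x) (w * u⁻¹ * x) := by
  have huw : Compatible k u w := (Compatible.of_kBruhatCov hu huv).trans hvw
  obtain ⟨a, b, ha, hb, rfl, hlt, hc⟩ := (kBruhatCov_iff hu).1 huv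
  have hab : a < b := ha.trans_lt hb
  obtain ⟨z, rfl⟩ : ∃ z, w = z * u := ⟨w * u⁻¹, by simp⟩
  obtain ⟨a', ha'⟩ := x.surjective (u a)
  obtain ⟨b', hb'⟩ := x.surjective (u b)
  have e₁ : z * u * u⁻¹ * x = z * x := by simp
  have e₂ : u * swap a b * u⁻¹ * x = x * swap a' b' := by
    rw [mul_swap_eq_swap_mul, mul_swap_eq_swap_mul, ha', hb']
    simp
  rw [e₁] at hxw
  rw [e₁, e₂]
  have hza : u b ≤ z (u a) := by simpa using hvw.le_of_le a ha
  have hzb : z (u b) ≤ u a := by simpa using hvw.le_of_gt b hb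
  have ha'l : a' ≤ l := by
    by_contra! h
    have := hxw.le_of_gt a' h
    rw [Perm.mul_apply, ha'] at this
    exact absurd (hlt.trans_le hza) (not_lt.mpr this)
  have hb'l : l < b' := by
    by_contra! h
    have := hxw.le_of_le b' h
    rw [Perm.mul_apply, hb'] at this
    exact absurd (hzb.trans_lt hlt) (not_lt.mpr this)
  -- a value strictly between those exchanged, by its side in `u`
  have left : ∀ c ≤ k, u a < u c → u c < u b → z (u c) < z (u a) := by
    intro c hck h₁ h₂
    have hne : c ≠ a := by rintro rfl; exact lt_irrefl _ h₁
    have hca : c < a := by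
      by_contra! h
      exact hc c (lt_of_le_of_ne h hne.symm) (hck.trans_lt hb) ⟨h₁, h₂⟩
    by_contra! h
    have h' := lt_of_le_of_ne h ((z.injective.comp u.injective).ne hne.symm)
    have hcb : c ≠ b := (hca.trans hab).ne
    have := hvw.separated c a hca (by simpa [swap_apply_of_ne_of_ne hne hcb] using h₂)
      (by simpa using h')
    exact absurd ha (not_le.mpr this.2)
  have right : ∀ c, k < c → u a < u c → u c < u b → z (u b) < z (u c) := by
    intro c hck h₁ h₂
    have hne : c ≠ b := by rintro rfl; exact lt_irrefl _ h₂
    have hbc : b < c := by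
      by_contra! h
      exact hc c (ha.trans_lt hck) (lt_of_le_of_ne h hne) ⟨h₁, h₂⟩
    by_contra! h
    have h' := lt_of_le_of_ne h ((z.injective.comp u.injective).ne hne)
    have hca : c ≠ a := (hab.trans hbc).ne'
    have := hvw.separated b c hbc (by simpa [swap_apply_of_ne_of_ne hca hne] using h₁)
      (by simpa using h')
    exact absurd hb (not_lt.mpr this.1)
  have between : ∀ y, u a < y → y < u b → z y < z (u a) ∧ z (u b) < z y := by
    intro y h₁ h₂
    obtain ⟨c, rfl⟩ := u.surjective y
    rcases le_or_gt c k with h | h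
    · exact ⟨left c h h₁ h₂, (hzb.trans_lt h₁).trans_le (huw.le_of_le c h)⟩
    · exact ⟨((huw.le_of_gt c h).trans_lt h₂).trans_le hza, right c h h₁ h₂⟩
  constructor
  · refine (kBruhatCov_iff hx).2 ⟨a', b', ha'l, hb'l, rfl, by rwa [ha', hb'], ?_⟩
    rintro c hac hcb ⟨h₁, h₂⟩
    rw [ha'] at h₁
    rw [hb'] at h₂
    obtain ⟨hz₁, hz₂⟩ := between _ h₁ h₂
    have s₁ := hxw.separated a' c hac (by rwa [ha']) (by simpa [ha'] using hz₁)
    have s₂ := hxw.separated c b' hcb (by rwa [hb']) (by simpa [hb'] using hz₂)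
    exact absurd s₁.2 (not_lt.mpr s₂.1)
  · constructor
    · intro i hi
      have := hxw.le_of_le i hi
      simp only [Perm.mul_apply, swap_apply_def] at this ⊢
      grind
    · intro i hi
      have := hxw.le_of_gt i hi
      simp only [Perm.mul_apply, swap_apply_def] at this ⊢
      grind
    · intro i j hij h₁ h₂
      have s := hxw.separated i j hij
      have bi := between (x i)
      have bj := between (x j)
      have hij' : x i ≠ x j := x.injective.ne hij.ne
      have i₁ : x i = u a → i = a' := fun h => x.injective (h.trans ha'.symm)
      have i₂ : x i = u b → i = b' := fun h => x.injective (h.trans hb'.symm)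
      have j₁ : x j = u a → j = a' := fun h => x.injective (h.trans ha'.symm)
      have j₂ : x j = u b → j = b' := fun h => x.injective (h.trans hb'.symm)
      simp only [Perm.mul_apply, swap_apply_def] at s h₁ h₂
      grind

lemma Compatible.replay_kBruhat {k l : ℕ+} {u v w x : Perm ℕ+} (hu : FinSupp u)
    (hx : FinSupp x) (huv : kBruhat k u v) (hvw : kBruhat k v w)
    (hxw : Compatible l x (w * u⁻¹ * x)) :
    kBruhat l x (v * u⁻¹ * x) ∧ Compatible l (v * u⁻¹ * x) (w * u⁻¹ * x) := by
  induction huv using Relation.ReflTransGen.head_induction_on generalizing x with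
  | refl =>
    have : v * v⁻¹ * x = x := by simp
    rw [this]
    exact ⟨Relation.ReflTransGen.refl, hxw⟩
  | @head u t hut htv ih =>
    have ht := FinSupp.of_kBruhatCov hu hut
    obtain ⟨h₁, h₂⟩ := Compatible.replay_kBruhatCov hu hx hut
      (.of_kBruhat ht (htv.trans hvw)) hxw
    have e : ∀ s : Perm ℕ+, s * t⁻¹ * (t * u⁻¹ * x) = s * u⁻¹ * x := fun s => by group
    have := ih ht (FinSupp.of_kBruhatCov hx h₁) (by rwa [e])
    rw [e, e] at this
    exact ⟨Relation.ReflTransGen.head h₁ this.1, this.2⟩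

/-- Chains `u ≤_k ηu ≤_k ξu` can be replayed from any `x ≤_l ξx`. -/
lemma kBruhat_replay {k l : ℕ+} {u x η ξ : Perm ℕ+} (hu : FinSupp u) (hx : FinSupp x)
    (h₁ : kBruhat k u (η * u)) (h₂ : kBruhat k (η * u) (ξ * u)) (h : kBruhat l x (ξ * x)) :
    kBruhat l x (η * x) ∧ kBruhat l (η * x) (ξ * x) := by
  have e : ∀ s : Perm ℕ+, s * u * u⁻¹ * x = s * x := fun s => by simp
  have r₁ := Compatible.replay_kBruhat hu hx h₁ h₂ (by rw [e]; exact .of_kBruhat hx h)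
  rw [e, e] at r₁
  have e' : ξ * u * (η * u)⁻¹ * (η * x) = ξ * x := by group
  have r₂ := Compatible.replay_kBruhat (FinSupp.of_kBruhat hu h₁) (FinSupp.of_kBruhat hx r₁.1)
    h₂ .refl (by rw [e']; exact r₁.2)
  rw [e'] at r₂
  exact ⟨r₁.1, r₂.1⟩

lemma coe_add_one_sub {n i : ℕ+} (h : i ≤ n) : ((n + 1 - i : ℕ+) : ℕ) + i = n + 1 := by
  rw [← PNat.add_coe, PNat.sub_add_of_lt (PNat.lt_add_one_iff.2 h), PNat.add_coe, PNat.one_coe]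

/-- The permutation reversing `1, …, n` and fixing all larger numbers. -/
def rev (n : ℕ+) : Perm ℕ+ :=
  Function.Involutive.toPerm (fun i => if i ≤ n then n + 1 - i else i) fun i => by
    by_cases h : i ≤ n
    · have h₁ := coe_add_one_sub h
      have h' : (n + 1 - i : ℕ+) ≤ n := by
        have := i.pos
        rw [← PNat.coe_le_coe]
        omega
      have h₂ := coe_add_one_sub h'
      simp only [h, h', if_true]
      apply PNat.eq
      omega
    · simp [h]

lemma coe_rev_of_le {n i : ℕ+} (h : i ≤ n) : (rev n i : ℕ) + i = n + 1 := by
  have : rev n i = n + 1 - i := if_pos h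
  rw [this, coe_add_one_sub h]

lemma rev_of_gt {n i : ℕ+} (h : n < i) : rev n i = i := if_neg (not_le.mpr h)

lemma rev_rev (n i : ℕ+) : rev n (rev n i) = i :=
  Function.Involutive.toPerm_involutive _ i

lemma finSupp_rev (n : ℕ+) : FinSupp (rev n) := by
  refine (Set.finite_Iic n).subset fun i hi => ?_
  by_contra h
  exact hi (rev_of_gt (not_le.mp h))

lemma kBruhatCov_mul_rev {k n : ℕ+} {u w : Perm ℕ+} (hu : FinSupp u) (hkn : k < n)
    {a b : ℕ+} (ha : a ≤ k) (hb : k < b) (hbn : b ≤ n) (hw : w = u * swap a b)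
    (hlt : u a < u b) (hc : ∀ c, a < c → c < b → ¬ (u a < u c ∧ u c < u b)) :
    kBruhatCov (n - k) (w * rev n) (u * rev n) := by
  subst hw
  have han : a ≤ n := ha.trans hkn.le
  have ra := coe_rev_of_le han
  have rb := coe_rev_of_le hbn
  have hk : ((n - k : ℕ+) : ℕ) + k = n := by
    rw [← PNat.add_coe, PNat.sub_add_of_lt hkn]
  rw [kBruhatCov_iff (finSupp_mul (finSupp_mul hu (finSupp_swap a b)) (finSupp_rev n))]
  refine ⟨rev n b, rev n a, ?_, ?_, ?_, ?_, ?_⟩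
  · rw [← PNat.coe_le_coe]; rw [← PNat.coe_lt_coe] at hb; omega
  · rw [← PNat.coe_lt_coe]; rw [← PNat.coe_le_coe] at ha; omega
  · rw [mul_swap_eq_swap_mul, mul_swap_eq_swap_mul u a b]
    simp [rev_rev, swap_comm (u a) (u b), ← mul_assoc]
  · simpa [rev_rev] using hlt
  · intro c hbc hca
    have hcn : c ≤ n := by
      have := a.pos
      rw [← PNat.coe_lt_coe] at hca
      rw [← PNat.coe_le_coe]; omega
    have rc := coe_rev_of_le hcn
    have h₁ : a < rev n c := by
      rw [← PNat.coe_lt_coe] at hca ⊢; omega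
    have h₂ : rev n c < b := by
      rw [← PNat.coe_lt_coe] at hbc ⊢; omega
    simpa [rev_rev, swap_apply_of_ne_of_ne h₁.ne' h₂.ne] using hc _ h₁ h₂

lemma kBruhat_mul_rev {k : ℕ+} {u w : Perm ℕ+} (hu : FinSupp u) (h : kBruhat k u w) :
    ∃ N, ∀ n, N ≤ n → kBruhat (n - k) (w * rev n) (u * rev n) := by
  induction h with
  | refl => exact ⟨1, fun _ _ => Relation.ReflTransGen.refl⟩
  | tail huv hvw ih =>
    obtain ⟨N, hN⟩ := ih
    have hv := FinSupp.of_kBruhat hu huv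
    obtain ⟨a, b, ha, hb, hw, hlt, hc⟩ := (kBruhatCov_iff hv).1 hvw
    refine ⟨max N b, fun n hn => ?_⟩
    have hbn := (le_max_right _ _).trans hn
    exact Relation.ReflTransGen.head
      (kBruhatCov_mul_rev hv (hb.trans_le hbn) ha hb hbn hw hlt hc)
      (hN n ((le_max_left _ _).trans hn))

lemma newOrder_one_of_kBruhat {k : ℕ+} {u η : Perm ℕ+} (hu : FinSupp u)
    (h : kBruhat k u (η * u)) : NewOrder 1 η :=
  ⟨u, k, hu, by rw [one_mul]; exact .refl, by rwa [one_mul]⟩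

lemma newOrder_mul_inv_of_kBruhat {k : ℕ+} {u η ξ ζ : Perm ℕ+} (hu : FinSupp u)
    (h₁ : kBruhat k u (η * u)) (h₂ : kBruhat k (η * u) (ξ * u))
    (h₃ : kBruhat k (ξ * u) (ζ * u)) :
    NewOrder 1 (ξ * ζ⁻¹) ∧ NewOrder (ξ * ζ⁻¹) (η * ζ⁻¹) := by
  have hη := FinSupp.of_kBruhat hu h₁
  have hξ := FinSupp.of_kBruhat hη h₂
  have hζ := FinSupp.of_kBruhat hξ h₃
  obtain ⟨N₂, hN₂⟩ := kBruhat_mul_rev hη h₂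
  obtain ⟨N₃, hN₃⟩ := kBruhat_mul_rev hξ h₃
  set n := max N₂ N₃
  have e : ∀ s : Perm ℕ+, s * ζ⁻¹ * (ζ * u * rev n) = s * u * rev n := fun s => by group
  have c₂ := hN₂ n (le_max_left _ _)
  have c₃ := hN₃ n (le_max_right _ _)
  rw [← e ξ] at c₃
  rw [← e ξ, ← e η] at c₂
  have hx := finSupp_mul hζ (finSupp_rev n)
  exact ⟨newOrder_one_of_kBruhat hx c₃, _, _, hx, c₃, c₂⟩

lemma newOrder_mul_inv {η ξ ζ : Perm ℕ+} (h₁ : NewOrder η ξ) (h₂ : NewOrder ξ ζ) :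
    NewOrder (ξ * ζ⁻¹) (η * ζ⁻¹) := by
  obtain ⟨u, k, hu, hη, hξ⟩ := h₁
  obtain ⟨x, l, hx, hx₁, hx₂⟩ := h₂
  obtain ⟨r₁, r₂⟩ := kBruhat_replay hu hx hη hξ hx₁
  exact (newOrder_mul_inv_of_kBruhat hx r₁ r₂ hx₂).2

lemma newOrder_one_mul_inv {η ζ : Perm ℕ+} (h : NewOrder η ζ) :
    NewOrder 1 (η * ζ⁻¹) ∧ NewOrder (η * ζ⁻¹) ζ⁻¹ := by
  obtain ⟨u, k, hu, h₁, h₂⟩ := h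
  have := newOrder_mul_inv_of_kBruhat (η := 1) hu (by rw [one_mul]; exact .refl)
    (by rwa [one_mul]) h₂
  rwa [one_mul] at this

end KBruhat

/-- The map `η ↦ ηζ⁻¹` is an order-reversing bijection from `[e,ζ]_⪯` onto
`[e,ζ⁻¹]_⪯`: it maps the first interval into the second, is onto the second,
and for `η, ξ ∈ [e,ζ]_⪯` one has `η ⪯ ξ ↔ ξζ⁻¹ ⪯ ηζ⁻¹`. -/
theorem stmt_14 (ζ : Equiv.Perm ℕ+) (hζ : FinSupp ζ) :
    (∀ η : Equiv.Perm ℕ+, NewOrder 1 η → NewOrder η ζ →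
        NewOrder 1 (η * ζ⁻¹) ∧ NewOrder (η * ζ⁻¹) ζ⁻¹) ∧
    (∀ ξ : Equiv.Perm ℕ+, NewOrder 1 ξ → NewOrder ξ ζ⁻¹ →
        ∃ η : Equiv.Perm ℕ+, NewOrder 1 η ∧ NewOrder η ζ ∧ η * ζ⁻¹ = ξ) ∧
    (∀ η ξ : Equiv.Perm ℕ+, NewOrder 1 η → NewOrder η ζ →
        NewOrder 1 ξ → NewOrder ξ ζ →
        (NewOrder η ξ ↔ NewOrder (ξ * ζ⁻¹) (η * ζ⁻¹))) := by
  refine ⟨fun η _ h => KBruhat.newOrder_one_mul_inv h, fun ξ _ h => ?_, fun η ξ _ hη _ hξ => ⟨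
    fun h => KBruhat.newOrder_mul_inv h hξ, fun h => ?_⟩⟩
  · have := KBruhat.newOrder_one_mul_inv h
    rw [inv_inv] at this
    exact ⟨ξ * ζ, this.1, this.2, by simp⟩
  · have := KBruhat.newOrder_mul_inv h (KBruhat.newOrder_one_mul_inv hη).2
    simpa using this
end
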